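/- (Witness value on isotropic states.) Let d ≥ 2, m ≥ 2, and p ∈ [0,1]. Let ρ_iso = (1 − p)|Φ⁺_d⟩⟨Φ⁺_d| + (p/d²) I_{d²} on ℂ^d ⊗ ℂ^d, and let W be the witness operator built from any m orthonormal bases of ℂ^d with U = I_d. Then Tr(W ρ_iso) = p·m/d + (1 − p)·m. -/

import Mathlib

open Matrix Kronecker BigOperators ComplexOrder

/-- The maximally entangled state `|Φ⁺_d⟩ = (1/√d) Σ_i e_i ⊗ e_i` on `ℂ^d ⊗ ℂ^d`. -/
noncomputable def phiPlus (d : ℕ) : Fin d × Fin d → ℂ :=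
  fun p => if p.1 = p.2 then ((Real.sqrt d : ℂ))⁻¹ else 0

/-- The witness operator `W = Σ_{z,a} |e^z_a⟩⟨e^z_a| ⊗ (U|e^z_a*⟩⟨e^z_a*|U†)`, where
`v*` denotes the componentwise complex conjugate `star v`. -/
noncomputable def witnessW (d m : ℕ) (e : Fin m → Fin d → Fin d → ℂ)
    (U : Matrix (Fin d) (Fin d) ℂ) : Matrix (Fin d × Fin d) (Fin d × Fin d) ℂ :=
  ∑ z : Fin m, ∑ a : Fin d,
    (vecMulVec (e z a) (star (e z a))) ⊗ₖ (U * vecMulVec (star (e z a)) (e z a) * Uᴴ)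

theorem aux_trace (d : ℕ) (v : Fin d → ℂ) (hv : star v ⬝ᵥ v = 1) :
    ((vecMulVec v (star v)) ⊗ₖ (vecMulVec (star v) v)).trace = 1 := by
  rw [trace_kronecker, trace_vecMulVec, trace_vecMulVec, dotProduct_comm v, hv, mul_one]

theorem aux_phi (d : ℕ) (v : Fin d → ℂ) (hv : star v ⬝ᵥ v = 1) :
    (((vecMulVec v (star v)) ⊗ₖ (vecMulVec (star v) v)) *
      vecMulVec (phiPlus d) (star (phiPlus d))).trace = (d : ℂ)⁻¹ := by
  have hs : ((Real.sqrt d : ℂ))⁻¹ * ((Real.sqrt d : ℂ))⁻¹ = (d : ℂ)⁻¹ := by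
    rw [← mul_inv, ← Complex.ofReal_mul, Real.mul_self_sqrt (Nat.cast_nonneg d)]
    simp
  have key : ((vecMulVec v (star v)) ⊗ₖ (vecMulVec (star v) v)) *ᵥ phiPlus d =
      fun q => ((Real.sqrt d : ℂ))⁻¹ * (v q.1 * star (v q.2)) := by
    funext q
    have h1 : ∑ i, star (v i) * v i = 1 := by simpa [dotProduct] using hv
    simp only [mulVec, dotProduct, Fintype.sum_prod_type, phiPlus, kroneckerMap_apply,
      vecMulVec_apply, mul_ite, mul_zero, Finset.sum_ite_eq, Finset.mem_univ, if_true,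
      Pi.star_apply]
    calc _ = ((Real.sqrt d : ℂ))⁻¹ * (v q.1 * star (v q.2)) * ∑ i, star (v i) * v i := by
          rw [Finset.mul_sum]
          exact Finset.sum_congr rfl fun i _ => by ring
      _ = _ := by rw [h1, mul_one]
  have h1 : ∑ i, v i * star (v i) = 1 := by
    rw [dotProduct_comm] at hv
    simpa [dotProduct] using hv
  rw [mul_vecMulVec, trace_vecMulVec, key]
  simp only [dotProduct, Fintype.sum_prod_type, phiPlus, Pi.star_apply, apply_ite star, star_zero,
    mul_ite, mul_zero, Finset.sum_ite_eq, Finset.mem_univ, if_true]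
  calc _ = ((Real.sqrt d : ℂ))⁻¹ * ((Real.sqrt d : ℂ))⁻¹ * ∑ i, v i * star (v i) := by
        rw [Finset.mul_sum]
        refine Finset.sum_congr rfl fun i _ => ?_
        have : star ((Real.sqrt d : ℂ))⁻¹ = ((Real.sqrt d : ℂ))⁻¹ := by
          rw [star_inv₀]; simp
        rw [this]; ring
    _ = _ := by rw [h1, hs, mul_one]

/-- Witness value on isotropic states: for `ρ_iso = (1−p)|Φ⁺_d⟩⟨Φ⁺_d| + (p/d²)I` and the
witness operator `W` built from any `m` orthonormal bases of `ℂ^d` with `U = I_d`,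
`Tr(W ρ_iso) = p·m/d + (1−p)·m`. -/
theorem stmt19 (d m : ℕ) (hd : 2 ≤ d) (hm : 2 ≤ m)
    (p : ℝ) (hp0 : 0 ≤ p) (hp1 : p ≤ 1)
    (e : Fin m → Fin d → Fin d → ℂ)
    (honb : ∀ z a b, star (e z a) ⬝ᵥ e z b = (if a = b then (1 : ℂ) else 0)) :
    (witnessW d m e 1 *
        (((1 - p : ℝ) : ℂ) • vecMulVec (phiPlus d) (star (phiPlus d)) +
          ((p / (d : ℝ) ^ 2 : ℝ) : ℂ) •
            (1 : Matrix (Fin d × Fin d) (Fin d × Fin d) ℂ))).trace =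
      ((p * m / d + (1 - p) * m : ℝ) : ℂ) := by
  have hv : ∀ z a, star (e z a) ⬝ᵥ e z a = 1 := fun z a => by simpa using honb z a a
  have hd0 : (d : ℂ) ≠ 0 := by
    have : d ≠ 0 := by omega
    exact_mod_cast this
  rw [mul_add, mul_smul_comm, mul_smul_comm, mul_one, trace_add, trace_smul, trace_smul]
  simp only [witnessW, conjTranspose_one, mul_one, one_mul, Finset.sum_mul, trace_sum]
  simp only [fun z a => aux_phi d (e z a) (hv z a), fun z a => aux_trace d (e z a) (hv z a)]
  simp only [Finset.sum_const, Finset.card_univ, Fintype.card_fin, nsmul_eq_mul, smul_eq_mul]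
  push_cast
  field_simp
  ring
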